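/- Assume in addition that γ : W → B is surjective. Then the assignment sending f ∈ H to the class of P(γ u) in range(P) / P(K), for any u ∈ W with D u = f, is a well-defined surjective 𝕜-linear map H → range(P) / P(K) whose kernel is exactly the image D(dom(D_P)); hence it induces a 𝕜-linear isomorphism of cokernels H / D(dom(D_P)) ≅ range(P) / P(K). -/

import Mathlib

namespace RelZeta

variable {𝕜 : Type*} [Field 𝕜] {W H B : Type*}
  [AddCommGroup W] [Module 𝕜 W] [AddCommGroup H] [Module 𝕜 H]
  [AddCommGroup B] [Module 𝕜 B]

/-- The Calderon subspace `K = γ(N) = γ(ker D) ⊆ B`. -/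
def Calderon (D : W →ₗ[𝕜] H) (γ : W →ₗ[𝕜] B) : Submodule 𝕜 B :=
  (LinearMap.ker D).map γ

/-- The domain `dom(D_P) = {u ∈ W : P(γ u) = 0}` of the boundary value problem. -/
def bvpDom (γ : W →ₗ[𝕜] B) (P : B →ₗ[𝕜] B) : Submodule 𝕜 W :=
  LinearMap.ker (P.comp γ)

/-- The boundary value problem `D_P : dom(D_P) → H`, the restriction of `D`. -/
def bvp (D : W →ₗ[𝕜] H) (γ : W →ₗ[𝕜] B) (P : B →ₗ[𝕜] B) :
    ↥(bvpDom γ P) →ₗ[𝕜] H :=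
  D.comp (bvpDom γ P).subtype

/-- `S(P) : K → range P`, the restriction of `P` to the Calderon subspace. -/
def SP (D : W →ₗ[𝕜] H) (γ : W →ₗ[𝕜] B) (P : B →ₗ[𝕜] B) :
    ↥(Calderon D γ) →ₗ[𝕜] ↥(LinearMap.range P) :=
  LinearMap.codRestrict (LinearMap.range P) (P.comp (Calderon D γ).subtype)
    (fun c => LinearMap.mem_range_self P _)

/-- A boundary value `P (γ u)` lies in `P(K)` iff `u` can be corrected to an element of `dom(D_P)`
without changing `D u`. -/
theorem rangeRestrict_mem_range_SP_iff (D : W →ₗ[𝕜] H) (γ : W →ₗ[𝕜] B) (P : B →ₗ[𝕜] B) (u : W) :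
    P.rangeRestrict (γ u) ∈ LinearMap.range (SP D γ P) ↔ D u ∈ LinearMap.range (bvp D γ P) := by
  constructor
  · rintro ⟨⟨_, n, hn, rfl⟩, h⟩
    have h' : P (γ n) = P (γ u) := congrArg Subtype.val h
    have hn' : D n = 0 := hn
    exact ⟨⟨u - n, by simp [bvpDom, h']⟩, by simp [bvp, hn']⟩
  · rintro ⟨⟨v, hv⟩, h⟩
    have hv' : P (γ v) = 0 := hv
    have h' : D v = D u := h
    exact ⟨⟨γ (u - v), u - v, by simp [h'], rfl⟩, Subtype.ext (by simp [SP, hv'])⟩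

/-- The map `W → range(P) / P(K)` sending `u` to the class of `P (γ u)`. -/
def boundaryClass (D : W →ₗ[𝕜] H) (γ : W →ₗ[𝕜] B) (P : B →ₗ[𝕜] B) :
    W →ₗ[𝕜] ↥(LinearMap.range P) ⧸ LinearMap.range (SP D γ P) :=
  (LinearMap.range (SP D γ P)).mkQ ∘ₗ P.rangeRestrict ∘ₗ γ

theorem ker_boundaryClass (D : W →ₗ[𝕜] H) (γ : W →ₗ[𝕜] B) (P : B →ₗ[𝕜] B) :
    LinearMap.ker (boundaryClass D γ P) = (LinearMap.range (bvp D γ P)).comap D := by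
  ext u
  exact (Submodule.Quotient.mk_eq_zero _).trans (rangeRestrict_mem_range_SP_iff D γ P u)

theorem boundaryClass_surjective (D : W →ₗ[𝕜] H) {γ : W →ₗ[𝕜] B} (P : B →ₗ[𝕜] B)
    (hγ : Function.Surjective γ) : Function.Surjective (boundaryClass D γ P) :=
  (Submodule.mkQ_surjective _).comp (P.surjective_rangeRestrict.comp hγ)

/-- If `γ` is surjective, the assignment `f ↦ [P(γ u)] ∈ range(P)/P(K)` (for any `u`
with `D u = f`) is a well-defined surjective `𝕜`-linear map `H → range(P)/P(K)`
whose kernel is exactly `D(dom(D_P))`; hence it induces a `𝕜`-linear isomorphism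
`H / D(dom(D_P)) ≅ range(P) / P(K)`.  (Here `P(K) = range S(P)` inside `range P`.) -/
theorem statement9 (D : W →ₗ[𝕜] H) (γ : W →ₗ[𝕜] B) (P : B →ₗ[𝕜] B)
    (hDsurj : Function.Surjective D)
    (hγinj : Set.InjOn γ (LinearMap.ker D))
    (hPidem : P.comp P = P)
    (hγsurj : Function.Surjective γ) :
    ∃ Φ : H →ₗ[𝕜] (↥(LinearMap.range P) ⧸ LinearMap.range (SP D γ P)),
      (∀ u : W, Φ (D u) =
        Submodule.Quotient.mk
          (⟨P (γ u), LinearMap.mem_range_self P (γ u)⟩ : ↥(LinearMap.range P))) ∧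
      Function.Surjective Φ ∧
      LinearMap.ker Φ = LinearMap.range (bvp D γ P) ∧
      ∃ e : (H ⧸ LinearMap.range (bvp D γ P)) ≃ₗ[𝕜]
          (↥(LinearMap.range P) ⧸ LinearMap.range (SP D γ P)),
        ∀ f : H, e (Submodule.Quotient.mk f) = Φ f := by
  have hker : LinearMap.ker D ≤ LinearMap.ker (boundaryClass D γ P) := by
    rw [ker_boundaryClass]
    exact LinearMap.ker_le_comap D
  let Φ := (LinearMap.ker D).liftQ (boundaryClass D γ P) hker ∘ₗ
    (D.quotKerEquivOfSurjective hDsurj).symm.toLinearMap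
  have hΦ (u : W) : Φ (D u) = boundaryClass D γ P u := by
    have h : (D.quotKerEquivOfSurjective hDsurj).symm (D u) = Submodule.Quotient.mk u :=
      (LinearEquiv.symm_apply_eq _).mpr rfl
    simp [Φ, h]
  have hsurj : Function.Surjective Φ := fun y ↦ by
    obtain ⟨u, rfl⟩ := boundaryClass_surjective D P hγsurj y
    exact ⟨D u, hΦ u⟩
  have hkerΦ : LinearMap.ker Φ = LinearMap.range (bvp D γ P) := by
    ext f
    obtain ⟨u, rfl⟩ := hDsurj f
    rw [LinearMap.mem_ker, hΦ, ← LinearMap.mem_ker, ker_boundaryClass, Submodule.mem_comap]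
  exact ⟨Φ, hΦ, hsurj, hkerΦ,
    Submodule.quotEquivOfEq _ _ hkerΦ.symm ≪≫ₗ Φ.quotKerEquivOfSurjective hsurj, fun _ ↦ rfl⟩

end RelZeta
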